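/- arXiv:1704.00282 — 6 statements merged into one kernel-verified Lean document; each statement's English description precedes it below -/
import Mathlib

section
/- Fix R₁ > 0 and for R₂ > R₁ set A(R₁,R₂) = −(R₂²·ln R₂ − R₁²·ln R₁ + R₂²·R₁ − R₁²·R₂)/(R₂² − R₁²). Then sup over r ∈ [R₁, R₂] of |ln r + A(R₁,R₂) + 1/2 + R₁R₂/(R₁+R₂)| tends to 0 as R₂ → R₁ from above. In particular, in the narrow-gap limit the coefficient ln r + A + 1/2 tends to −R₁/2. -/
open Filter Topology

/-- The error of the narrow-gap approximation at the inner radius `r = a`, written with the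
slope of the logarithm. -/
lemma dean_inner_coefficient_eq {a b : ℝ} (ha : 0 < a) (hab : a < b) :
    Real.log a + -(b ^ 2 * Real.log b - a ^ 2 * Real.log a + b ^ 2 * a - a ^ 2 * b) /
        (b ^ 2 - a ^ 2) + 1 / 2 + a * b / (a + b) =
      1 / 2 - b ^ 2 / (a + b) * slope Real.log a b := by
  have h₁ : b - a ≠ 0 := (sub_pos.2 hab).ne'
  have h₂ : a + b ≠ 0 := by linarith
  rw [slope_def_field, show b ^ 2 - a ^ 2 = (b - a) * (a + b) by ring]
  field_simp
  ring

lemma tendsto_dean_inner_coefficient {a : ℝ} (ha : 0 < a) :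
    Tendsto (fun b => Real.log a +
        -(b ^ 2 * Real.log b - a ^ 2 * Real.log a + b ^ 2 * a - a ^ 2 * b) /
        (b ^ 2 - a ^ 2) + 1 / 2 + a * b / (a + b)) (𝓝[>] a) (𝓝 0) := by
  have hs : Tendsto (slope Real.log a) (𝓝[>] a) (𝓝 a⁻¹) :=
    (hasDerivAt_iff_tendsto_slope.1 (Real.hasDerivAt_log ha.ne')).mono_left
      (nhdsWithin_mono _ fun _ hx => ne_of_gt hx)
  have hq : Tendsto (fun b => b ^ 2 / (a + b)) (𝓝[>] a) (𝓝 (a ^ 2 / (a + a))) := by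
    have : ContinuousAt (fun b => b ^ 2 / (a + b)) a := by
      fun_prop (disch := positivity)
    exact this.tendsto.mono_left nhdsWithin_le_nhds
  have h := (hq.mul hs).const_sub (1 / 2)
  rw [show 1 / 2 - a ^ 2 / (a + a) * a⁻¹ = 0 by field_simp; ring] at h
  refine h.congr' ?_
  filter_upwards [self_mem_nhdsWithin] with b hb
  exact (dean_inner_coefficient_eq ha hb).symm

/-- Narrow-gap asymptotics of the coefficient `ln r + A + 1/2` in the linearized
azimuthal momentum equation of the Dean problem: with `A = A(R₁,R₂)` determined by
the boundary conditions, `sup_{r ∈ [R₁,R₂]} |ln r + A + 1/2 + R₁R₂/(R₁+R₂)| → 0`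
as `R₂ → R₁⁺`; in particular (for any choice `r = r(R₂) ∈ [R₁,R₂]`) the coefficient
tends to `-R₁/2`. -/
theorem dean_narrow_gap_coefficient_theta (R₁ : ℝ) (hR₁ : 0 < R₁) :
    let A : ℝ → ℝ := fun R₂ =>
      -(R₂ ^ 2 * Real.log R₂ - R₁ ^ 2 * Real.log R₁ + R₂ ^ 2 * R₁ - R₁ ^ 2 * R₂) /
        (R₂ ^ 2 - R₁ ^ 2)
    Tendsto (fun R₂ => ⨆ r ∈ Set.Icc R₁ R₂,
        |Real.log r + A R₂ + 1 / 2 + R₁ * R₂ / (R₁ + R₂)|)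
      (𝓝[>] R₁) (𝓝 0) ∧
    ∀ r : ℝ → ℝ, (∀ R₂, R₁ < R₂ → r R₂ ∈ Set.Icc R₁ R₂) →
      Tendsto (fun R₂ => Real.log (r R₂) + A R₂ + 1 / 2) (𝓝[>] R₁) (𝓝 (-(R₁ / 2))) := by
  intro A
  set E : ℝ → ℝ := fun b => Real.log R₁ + A b + 1 / 2 + R₁ * b / (R₁ + b) with hE
  set B : ℝ → ℝ := fun b => Real.log b - Real.log R₁ + |E b| with hB
  have hE0 : Tendsto E (𝓝[>] R₁) (𝓝 0) := tendsto_dean_inner_coefficient hR₁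
  have hB0 : Tendsto B (𝓝[>] R₁) (𝓝 0) := by
    have hlog : Tendsto Real.log (𝓝[>] R₁) (𝓝 (Real.log R₁)) :=
      (Real.continuousAt_log hR₁.ne').tendsto.mono_left nhdsWithin_le_nhds
    simpa using (hlog.sub_const (Real.log R₁)).add hE0.abs
  have hle : ∀ b r, r ∈ Set.Icc R₁ b →
      |Real.log r + A b + 1 / 2 + R₁ * b / (R₁ + b)| ≤ B b := by
    intro b r hr
    have h₁ := Real.log_le_log hR₁ hr.1
    have h₂ := Real.log_le_log (hR₁.trans_le hr.1) hr.2
    calc |Real.log r + A b + 1 / 2 + R₁ * b / (R₁ + b)|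
        = |(Real.log r - Real.log R₁) + E b| := by rw [hE]; ring_nf
      _ ≤ |Real.log r - Real.log R₁| + |E b| := abs_add_le _ _
      _ ≤ B b := by rw [abs_of_nonneg (sub_nonneg.2 h₁)]; simp only [hB]; linarith
  constructor
  · refine squeeze_zero' (Eventually.of_forall fun b => ?_) ?_ hB0
    · exact Real.iSup_nonneg fun r => Real.iSup_nonneg fun _ => abs_nonneg _
    · filter_upwards [self_mem_nhdsWithin] with b hb
      have hBb : 0 ≤ B b := (abs_nonneg _).trans (hle b b ⟨le_of_lt hb, le_rfl⟩)
      exact Real.iSup_le (fun r => Real.iSup_le (hle b r) hBb) hBb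
  · intro r hr
    have hd : Tendsto (fun b => Real.log (r b) + A b + 1 / 2 + R₁ * b / (R₁ + b))
        (𝓝[>] R₁) (𝓝 0) := by
      refine squeeze_zero_norm' ?_ hB0
      filter_upwards [self_mem_nhdsWithin] with b hb
      exact hle b (r b) (hr b hb)
    have hq : Tendsto (fun b => R₁ * b / (R₁ + b)) (𝓝[>] R₁) (𝓝 (R₁ * R₁ / (R₁ + R₁))) := by
      have : ContinuousAt (fun b => R₁ * b / (R₁ + b)) R₁ := by
        fun_prop (disch := positivity)
      exact this.tendsto.mono_left nhdsWithin_le_nhds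
    have h := hd.sub hq
    rw [show 0 - R₁ * R₁ / (R₁ + R₁) = -(R₁ / 2) by field_simp; ring] at h
    simpa only [add_sub_cancel_right] using h
end

section
/- Fix R₁ > 0 and for R₂ > R₁ set A(R₁,R₂) = −(R₂²·ln R₂ − R₁²·ln R₁ + R₂²·R₁ − R₁²·R₂)/(R₂² − R₁²) and B(R₁,R₂) = (R₁²·R₂²·(ln R₂ − ln R₁) + R₂⁴·R₁ − R₁⁴·R₂)/(R₂² − R₁²). Then sup over r ∈ [R₁, R₂] of |ln r + A(R₁,R₂) + B(R₁,R₂)/r² − 2R₁R₂/(R₁+R₂)| tends to 0 as R₂ → R₁ from above. In particular, in the narrow-gap limit the coefficient ln r + A + B/r² tends to R₁. -/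
open Filter Topology

lemma tendsto_log_sub_div_sub {a : ℝ} (ha : 0 < a) :
    Tendsto (fun b => (Real.log b - Real.log a) / (b - a)) (𝓝[>] a) (𝓝 a⁻¹) := by
  have h := ((Real.hasDerivAt_log ha.ne').tendsto_slope).mono_left
    (nhdsWithin_mono a (fun x (hx : a < x) => hx.ne'))
  exact h.congr fun b => slope_def_field Real.log a b

lemma tendsto_dean_A {a : ℝ} (ha : 0 < a) :
    Tendsto (fun b => -(b ^ 2 * Real.log b - a ^ 2 * Real.log a + b ^ 2 * a - a ^ 2 * b) /
      (b ^ 2 - a ^ 2)) (𝓝[>] a) (𝓝 (-(Real.log a + 1 / 2 + a / 2))) := by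
  have hs := tendsto_log_sub_div_sub ha
  have hb : Tendsto (fun b : ℝ => b) (𝓝[>] a) (𝓝 a) := tendsto_nhdsWithin_of_tendsto_nhds tendsto_id
  have haa : a + a ≠ 0 := by positivity
  have h := ((((((hb.pow 2).mul hs).add (hb.const_mul a)).div
    (hb.const_add a) haa)).const_add (Real.log a)).neg
  have e : -(Real.log a + 1 / 2 + a / 2) =
      -(Real.log a + (a ^ 2 * a⁻¹ + a * a) / (a + a)) := by
    field_simp
    ring
  rw [e]
  refine h.congr' ?_
  filter_upwards [self_mem_nhdsWithin] with b (hab : a < b)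
  have h1 : b - a ≠ 0 := (sub_pos.2 hab).ne'
  have h2 : a + b ≠ 0 := by linarith
  have h3 : b ^ 2 - a ^ 2 = (b - a) * (a + b) := by ring
  simp only [Pi.div_apply]
  rw [h3]
  field_simp
  ring

lemma tendsto_dean_B {a : ℝ} (ha : 0 < a) :
    Tendsto (fun b => (a ^ 2 * b ^ 2 * (Real.log b - Real.log a) + b ^ 4 * a - a ^ 4 * b) /
      (b ^ 2 - a ^ 2)) (𝓝[>] a) (𝓝 (a ^ 2 / 2 + 3 * a ^ 3 / 2)) := by
  have hs := tendsto_log_sub_div_sub ha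
  have hb : Tendsto (fun b : ℝ => b) (𝓝[>] a) (𝓝 a) := tendsto_nhdsWithin_of_tendsto_nhds tendsto_id
  have haa : a + a ≠ 0 := by positivity
  have h := ((((hb.pow 2).const_mul (a ^ 2)).mul hs).add ((hb.const_mul a).mul
    (((hb.pow 2).add (hb.const_mul a)).add_const (a ^ 2)))).div (hb.const_add a) haa
  have e : a ^ 2 / 2 + 3 * a ^ 3 / 2 =
      (a ^ 2 * a ^ 2 * a⁻¹ + a * a * (a ^ 2 + a * a + a ^ 2)) / (a + a) := by
    field_simp
    ring
  rw [e]
  refine h.congr' ?_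
  filter_upwards [self_mem_nhdsWithin] with b (hab : a < b)
  have h1 : b - a ≠ 0 := (sub_pos.2 hab).ne'
  have h2 : a + b ≠ 0 := by linarith
  have h3 : b ^ 2 - a ^ 2 = (b - a) * (a + b) := by ring
  simp only [Pi.div_apply]
  rw [h3]
  field_simp
  ring

/-- On `[a, b]` the coefficient differs from its value at `a` by at most the variation of
`log r` and `β / r ^ 2`. -/
lemma abs_log_add_div_sq_sub_le {a b r : ℝ} (ha : 0 < a) (hr : r ∈ Set.Icc a b) (α β m : ℝ) :
    |Real.log r + α + β / r ^ 2 - m| ≤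
      (Real.log b - Real.log a) + |Real.log a + α + β / a ^ 2 - m| +
        |β| * ((a ^ 2)⁻¹ - (b ^ 2)⁻¹) := by
  obtain ⟨har, hrb⟩ := hr
  have hr0 : 0 < r := ha.trans_le har
  have h1 : Real.log a ≤ Real.log r := Real.log_le_log ha har
  have h2 : Real.log r ≤ Real.log b := Real.log_le_log hr0 hrb
  have h3 : (r ^ 2)⁻¹ ≤ (a ^ 2)⁻¹ := by gcongr
  have h4 : (b ^ 2)⁻¹ ≤ (r ^ 2)⁻¹ := by gcongr
  have e : Real.log r + α + β / r ^ 2 - m = (Real.log r - Real.log a) +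
      (Real.log a + α + β / a ^ 2 - m) + β * ((r ^ 2)⁻¹ - (a ^ 2)⁻¹) := by
    simp only [div_eq_mul_inv]
    ring
  rw [e]
  refine (abs_add_three _ _ _).trans ?_
  rw [abs_mul, abs_of_nonneg (sub_nonneg.2 h1), abs_of_nonpos (sub_nonpos.2 h3)]
  gcongr
  linarith

/-- Narrow-gap asymptotics of the coefficient `ln r + A + B/r²` in the linearized
radial momentum equation of the Dean problem: with `A = A(R₁,R₂)`, `B = B(R₁,R₂)`
determined by the boundary conditions,
`sup_{r ∈ [R₁,R₂]} |ln r + A + B/r² - 2R₁R₂/(R₁+R₂)| → 0` as `R₂ → R₁⁺`; in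
particular (for any choice `r = r(R₂) ∈ [R₁,R₂]`) the coefficient tends to `R₁`. -/
theorem dean_narrow_gap_coefficient_r (R₁ : ℝ) (hR₁ : 0 < R₁) :
    let A : ℝ → ℝ := fun R₂ =>
      -(R₂ ^ 2 * Real.log R₂ - R₁ ^ 2 * Real.log R₁ + R₂ ^ 2 * R₁ - R₁ ^ 2 * R₂) /
        (R₂ ^ 2 - R₁ ^ 2)
    let B : ℝ → ℝ := fun R₂ =>
      (R₁ ^ 2 * R₂ ^ 2 * (Real.log R₂ - Real.log R₁) + R₂ ^ 4 * R₁ - R₁ ^ 4 * R₂) /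
        (R₂ ^ 2 - R₁ ^ 2)
    Tendsto (fun R₂ => ⨆ r ∈ Set.Icc R₁ R₂,
        |Real.log r + A R₂ + B R₂ / r ^ 2 - 2 * R₁ * R₂ / (R₁ + R₂)|)
      (𝓝[>] R₁) (𝓝 0) ∧
    ∀ r : ℝ → ℝ, (∀ R₂, R₁ < R₂ → r R₂ ∈ Set.Icc R₁ R₂) →
      Tendsto (fun R₂ => Real.log (r R₂) + A R₂ + B R₂ / (r R₂) ^ 2) (𝓝[>] R₁) (𝓝 R₁) := by
  intro A B
  have hA : Tendsto A (𝓝[>] R₁) _ := tendsto_dean_A hR₁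
  have hB : Tendsto B (𝓝[>] R₁) _ := tendsto_dean_B hR₁
  have hb : Tendsto (fun b : ℝ => b) (𝓝[>] R₁) (𝓝 R₁) :=
    tendsto_nhdsWithin_of_tendsto_nhds tendsto_id
  have hM : Tendsto (fun b => 2 * R₁ * b / (R₁ + b)) (𝓝[>] R₁) (𝓝 R₁) := by
    have h := (hb.const_mul (2 * R₁)).div (hb.const_add R₁) (by positivity)
    have e : 2 * R₁ * R₁ / (R₁ + R₁) = R₁ := by
      field_simp
      ring
    rwa [e] at h
  let g : ℝ → ℝ := fun b => (Real.log b - Real.log R₁) +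
    |Real.log R₁ + A b + B b / R₁ ^ 2 - 2 * R₁ * b / (R₁ + b)| +
      |B b| * ((R₁ ^ 2)⁻¹ - (b ^ 2)⁻¹)
  have hg : Tendsto g (𝓝[>] R₁) (𝓝 0) := by
    have h := (((hb.log hR₁.ne').sub_const (Real.log R₁)).add
      (((hA.const_add (Real.log R₁)).add (hB.div_const (R₁ ^ 2))).sub hM).abs).add
      (hB.abs.mul (((hb.pow 2).inv₀ (by positivity)).const_sub ((R₁ ^ 2)⁻¹)))
    have e : Real.log R₁ + -(Real.log R₁ + 1 / 2 + R₁ / 2) +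
        (R₁ ^ 2 / 2 + 3 * R₁ ^ 3 / 2) / R₁ ^ 2 - R₁ = 0 := by
      field_simp
      ring
    simpa only [e, sub_self, abs_zero, mul_zero, add_zero] using h
  have hle : ∀ b, ∀ r ∈ Set.Icc R₁ b,
      |Real.log r + A b + B b / r ^ 2 - 2 * R₁ * b / (R₁ + b)| ≤ g b :=
    fun b r hr => abs_log_add_div_sq_sub_le hR₁ hr _ _ _
  refine ⟨?_, fun r hr => ?_⟩
  · refine tendsto_of_tendsto_of_tendsto_of_le_of_le' tendsto_const_nhds hg
      (Eventually.of_forall fun b => Real.iSup_nonneg fun r => Real.iSup_nonneg fun _ =>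
        abs_nonneg _) ?_
    filter_upwards [self_mem_nhdsWithin] with b (hab : R₁ < b)
    have hg0 : 0 ≤ g b := (abs_nonneg _).trans (hle b R₁ ⟨le_rfl, hab.le⟩)
    exact Real.iSup_le (fun r => Real.iSup_le (hle b r) hg0) hg0
  · have h : Tendsto (fun b => Real.log (r b) + A b + B b / (r b) ^ 2 -
        2 * R₁ * b / (R₁ + b)) (𝓝[>] R₁) (𝓝 0) := by
      refine squeeze_zero_norm' ?_ hg
      filter_upwards [self_mem_nhdsWithin] with b hab
      exact hle b (r b) (hr b hab)
    simpa only [sub_add_cancel, zero_add] using h.add hM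
end

section
/- Let L > 0 be real and set λ₀ = min over positive integers m of π²·√(1 + L²/m²)·(1 + m²/L²). Then for every real λ with 0 < λ < λ₀, every i ∈ {1,2} and all positive integers m, n, one has β^i_{mn}(λ) := −π²(m²/L² + n²) + (−1)^{i+1}·λ·m/√(m² + n²L²) < 0. -/
/-- Linear stability of the basic Dean flow below the critical parameter: if `λ₀`
is the minimum over positive integers `m` of `π² √(1 + L²/m²) (1 + m²/L²)`, then
for every `0 < λ < λ₀`, every `i ∈ {1,2}` and all positive integers `m`, `n`, the
eigenvalue `β^i_{mn}(λ) = -π²(m²/L² + n²) + (-1)^{i+1} λ m/√(m² + n²L²)` is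
negative. -/
theorem dean_linear_stability (L : ℝ) (hL : 0 < L) (lam₀ : ℝ)
    (hmin : IsLeast {x : ℝ | ∃ m : ℕ, 0 < m ∧
      x = Real.pi ^ 2 * Real.sqrt (1 + L ^ 2 / (m : ℝ) ^ 2) * (1 + (m : ℝ) ^ 2 / L ^ 2)} lam₀)
    (lam : ℝ) (hlam : 0 < lam) (hlam₀ : lam < lam₀)
    (i : ℕ) (hi : i = 1 ∨ i = 2) (m n : ℕ) (hm : 0 < m) (hn : 0 < n) :
    -Real.pi ^ 2 * ((m : ℝ) ^ 2 / L ^ 2 + (n : ℝ) ^ 2) +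
      (-1 : ℝ) ^ (i + 1) * lam * (m : ℝ) / Real.sqrt ((m : ℝ) ^ 2 + (n : ℝ) ^ 2 * L ^ 2)
      < 0 := by
  have hm' : (0 : ℝ) < m := by exact_mod_cast hm
  have hn' : (1 : ℝ) ≤ n := by exact_mod_cast hn
  have hn2 : (1 : ℝ) ≤ (n : ℝ) ^ 2 := one_le_pow₀ hn'
  have hL2 : 0 < L ^ 2 := by positivity
  have hS : 0 < Real.sqrt ((m : ℝ) ^ 2 + (n : ℝ) ^ 2 * L ^ 2) := Real.sqrt_pos.2 (by positivity)
  have hpi : 0 < Real.pi ^ 2 := by positivity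
  have hlt := hlam₀.trans_le (hmin.2 ⟨m, hm, rfl⟩)
  have hsqrt : Real.sqrt (1 + L ^ 2 / (m : ℝ) ^ 2) * m ≤
      Real.sqrt ((m : ℝ) ^ 2 + (n : ℝ) ^ 2 * L ^ 2) := by
    apply Real.le_sqrt_of_sq_le
    rw [mul_pow, Real.sq_sqrt (by positivity), add_mul, div_mul_cancel₀ _ (by positivity)]
    nlinarith
  have hkey : lam * m / Real.sqrt ((m : ℝ) ^ 2 + (n : ℝ) ^ 2 * L ^ 2) <
      Real.pi ^ 2 * ((m : ℝ) ^ 2 / L ^ 2 + (n : ℝ) ^ 2) := by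
    rw [div_lt_iff₀ hS]
    calc lam * m
        < Real.pi ^ 2 * Real.sqrt (1 + L ^ 2 / (m : ℝ) ^ 2) * (1 + (m : ℝ) ^ 2 / L ^ 2) * m :=
          mul_lt_mul_of_pos_right hlt hm'
      _ = Real.pi ^ 2 * ((m : ℝ) ^ 2 / L ^ 2 + 1) *
          (Real.sqrt (1 + L ^ 2 / (m : ℝ) ^ 2) * m) := by ring
      _ ≤ Real.pi ^ 2 * ((m : ℝ) ^ 2 / L ^ 2 + (n : ℝ) ^ 2) *
          Real.sqrt ((m : ℝ) ^ 2 + (n : ℝ) ^ 2 * L ^ 2) := by gcongr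
  have hpos : 0 < lam * m / Real.sqrt ((m : ℝ) ^ 2 + (n : ℝ) ^ 2 * L ^ 2) := by positivity
  rcases hi with rfl | rfl
  · norm_num
    linarith
  · have hneg : (-1 : ℝ) ^ (2 + 1) * lam * m = -(lam * m) := by ring
    rw [hneg, neg_div]
    linarith
end

section
/- Let L > 0 be real, λ_m = π²·√(1 + L²/m²)·(1 + m²/L²) for positive integers m, and suppose m₀ is a positive integer with λ_{m₀} < λ_m for all positive integers m ≠ m₀; set λ₀ = λ_{m₀}. Then there exists δ > 0 such that for every real λ with λ₀ − δ < λ < λ₀ + δ: (a) β¹_{m₀1}(λ) < 0 if λ < λ₀, β¹_{m₀1}(λ) = 0 if λ = λ₀, and β¹_{m₀1}(λ) > 0 if λ > λ₀; and (b) β^i_{mn}(λ) < 0 for every triple (i, m, n) with i ∈ {1,2}, m, n positive integers, and (i, m, n) ≠ (1, m₀, 1). Here β^i_{mn}(λ) = −π²(m²/L² + n²) + (−1)^{i+1}·λ·m/√(m² + n²L²). -/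
open Filter Topology in
/-- A strict minimizer of a sequence tending to infinity is separated from the other values by a
positive gap. -/
lemma exists_gap_of_tendsto_atTop {f : ℕ → ℝ} (hf : Tendsto f atTop atTop) {p : ℕ → Prop} {c : ℝ}
    (h : ∀ m, p m → c < f m) : ∃ δ : ℝ, 0 < δ ∧ ∀ m, p m → c + δ ≤ f m := by
  obtain ⟨N, hN⟩ := eventually_atTop.1 (hf.eventually_ge_atTop (c + 1))
  have hsmall : ∀ᶠ δ : ℝ in 𝓝[>] 0, ∀ m ∈ Finset.range N, p m → c + δ ≤ f m := by
    rw [Filter.eventually_all_finset]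
    intro m _
    by_cases hm : p m
    · have : ∀ᶠ δ : ℝ in 𝓝 0, δ < f m - c := eventually_lt_nhds (by linarith [h m hm])
      filter_upwards [this.filter_mono nhdsWithin_le_nhds] with δ hδ _
      linarith
    · exact Eventually.of_forall fun δ hp => absurd hp hm
  have hone : ∀ᶠ δ : ℝ in 𝓝[>] 0, δ < 1 :=
    (eventually_lt_nhds one_pos).filter_mono nhdsWithin_le_nhds
  obtain ⟨δ, hδ, hδ1, hpos⟩ := (hsmall.and (hone.and self_mem_nhdsWithin)).exists
  refine ⟨δ, hpos, fun m hm => ?_⟩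
  by_cases hmN : m < N
  · exact hδ m (Finset.mem_range.2 hmN) hm
  · linarith [hN m (not_lt.1 hmN)]

/-- The critical parameter at which the eigenvalue with wave numbers `m`, `n` vanishes. -/
noncomputable def deanCritical (L m n : ℝ) : ℝ :=
  Real.pi ^ 2 * (m ^ 2 / L ^ 2 + n ^ 2) * (Real.sqrt (m ^ 2 + n ^ 2 * L ^ 2) / m)

lemma deanCritical_one {L m : ℝ} (hL : 0 < L) (hm : 0 < m) :
    deanCritical L m 1 =
      Real.pi ^ 2 * Real.sqrt (1 + L ^ 2 / m ^ 2) * (1 + m ^ 2 / L ^ 2) := by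
  have h : Real.sqrt (1 + L ^ 2 / m ^ 2) = Real.sqrt (m ^ 2 + 1 ^ 2 * L ^ 2) / m := by
    rw [show 1 + L ^ 2 / m ^ 2 = (m ^ 2 + 1 ^ 2 * L ^ 2) / m ^ 2 by field_simp,
      Real.sqrt_div (by positivity), Real.sqrt_sq hm.le]
  rw [deanCritical, h]
  ring

lemma dean_eigenvalue_eq {L m n : ℝ} (hL : 0 < L) (hm : 0 < m) (μ : ℝ) :
    -Real.pi ^ 2 * (m ^ 2 / L ^ 2 + n ^ 2) + μ * m / Real.sqrt (m ^ 2 + n ^ 2 * L ^ 2) =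
      m / Real.sqrt (m ^ 2 + n ^ 2 * L ^ 2) * (μ - deanCritical L m n) := by
  have hs : 0 < Real.sqrt (m ^ 2 + n ^ 2 * L ^ 2) := Real.sqrt_pos.2 (by positivity)
  rw [deanCritical]
  generalize Real.sqrt (m ^ 2 + n ^ 2 * L ^ 2) = s at hs ⊢
  field_simp
  ring

lemma one_le_sqrt_div {L m n : ℝ} (hm : 0 < m) :
    1 ≤ Real.sqrt (m ^ 2 + n ^ 2 * L ^ 2) / m := by
  rw [one_le_div hm]
  exact Real.le_sqrt_of_sq_le (by nlinarith [sq_nonneg (n * L)])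

lemma deanCritical_one_add_le {L m n : ℝ} (hm : 0 < m) (hn : 1 ≤ n) :
    deanCritical L m 1 + Real.pi ^ 2 * (n ^ 2 - 1) ≤ deanCritical L m n := by
  have hn2 : 1 ≤ n ^ 2 := one_le_pow₀ hn
  have h1 : Real.sqrt (m ^ 2 + 1 ^ 2 * L ^ 2) / m ≤ Real.sqrt (m ^ 2 + n ^ 2 * L ^ 2) / m := by
    gcongr
  have h2 := one_le_sqrt_div (L := L) (n := n) hm
  have h3 : Real.pi ^ 2 * (n ^ 2 - 1) * 1 ≤
      Real.pi ^ 2 * (n ^ 2 - 1) * (Real.sqrt (m ^ 2 + n ^ 2 * L ^ 2) / m) :=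
    mul_le_mul_of_nonneg_left h2 (mul_nonneg (by positivity) (by linarith))
  have h4 : Real.pi ^ 2 * (m ^ 2 / L ^ 2 + 1 ^ 2) * (Real.sqrt (m ^ 2 + 1 ^ 2 * L ^ 2) / m) ≤
      Real.pi ^ 2 * (m ^ 2 / L ^ 2 + 1 ^ 2) * (Real.sqrt (m ^ 2 + n ^ 2 * L ^ 2) / m) :=
    mul_le_mul_of_nonneg_left h1 (by positivity)
  rw [deanCritical, deanCritical]
  linarith

open Filter in
lemma tendsto_deanCritical_one {L : ℝ} (hL : 0 < L) :
    Tendsto (fun m : ℕ => deanCritical L m 1) atTop atTop := by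
  have h : Tendsto (fun m : ℕ => Real.pi ^ 2 / L ^ 2 * (m : ℝ) ^ 2) atTop atTop :=
    ((tendsto_pow_atTop two_ne_zero).comp tendsto_natCast_atTop_atTop).const_mul_atTop
      (by positivity)
  refine tendsto_atTop_mono' _ ?_ h
  filter_upwards [eventually_gt_atTop 0] with m hm
  have h1 := one_le_sqrt_div (L := L) (n := 1) (Nat.cast_pos.2 hm : (0 : ℝ) < m)
  calc Real.pi ^ 2 / L ^ 2 * (m : ℝ) ^ 2
      ≤ Real.pi ^ 2 * ((m : ℝ) ^ 2 / L ^ 2 + 1 ^ 2) * 1 := by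
        have := sq_nonneg Real.pi
        have e : Real.pi ^ 2 / L ^ 2 * (m : ℝ) ^ 2 = Real.pi ^ 2 * ((m : ℝ) ^ 2 / L ^ 2) := by ring
        rw [e]
        linarith
    _ ≤ deanCritical L m 1 := mul_le_mul_of_nonneg_left h1 (by positivity)


/-- Principle of exchange of stabilities for the Dean problem: if `m₀` is the
unique positive integer minimizing the critical numbers
`λ_m = π² √(1 + L²/m²) (1 + m²/L²)` and `λ₀ = λ_{m₀}`, then there is `δ > 0` such
that for `λ₀ - δ < λ < λ₀ + δ` the eigenvalue `β¹_{m₀1}(λ)` is negative, zero, or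
positive according as `λ < λ₀`, `λ = λ₀`, `λ > λ₀`, while all other eigenvalues
`β^i_{mn}(λ)` with `(i,m,n) ≠ (1,m₀,1)` remain negative. -/
theorem dean_PES (L : ℝ) (hL : 0 < L) (m₀ : ℕ) (hm₀ : 0 < m₀)
    (hstrict : ∀ m : ℕ, 0 < m → m ≠ m₀ →
      Real.pi ^ 2 * Real.sqrt (1 + L ^ 2 / (m₀ : ℝ) ^ 2) * (1 + (m₀ : ℝ) ^ 2 / L ^ 2) <
        Real.pi ^ 2 * Real.sqrt (1 + L ^ 2 / (m : ℝ) ^ 2) * (1 + (m : ℝ) ^ 2 / L ^ 2)) :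
    let lam₀ : ℝ := Real.pi ^ 2 * Real.sqrt (1 + L ^ 2 / (m₀ : ℝ) ^ 2) *
      (1 + (m₀ : ℝ) ^ 2 / L ^ 2)
    let β : ℕ → ℕ → ℕ → ℝ → ℝ := fun i m n lam =>
      -Real.pi ^ 2 * ((m : ℝ) ^ 2 / L ^ 2 + (n : ℝ) ^ 2) +
        (-1 : ℝ) ^ (i + 1) * lam * (m : ℝ) / Real.sqrt ((m : ℝ) ^ 2 + (n : ℝ) ^ 2 * L ^ 2)
    ∃ δ : ℝ, 0 < δ ∧ ∀ lam : ℝ, lam₀ - δ < lam → lam < lam₀ + δ →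
      ((lam < lam₀ → β 1 m₀ 1 lam < 0) ∧
       (lam = lam₀ → β 1 m₀ 1 lam = 0) ∧
       (lam₀ < lam → 0 < β 1 m₀ 1 lam)) ∧
      ∀ i m n : ℕ, (i = 1 ∨ i = 2) → 0 < m → 0 < n → (i, m, n) ≠ (1, m₀, 1) →
        β i m n lam < 0 := by
  intro lam₀ β
  have hc : ∀ m : ℕ, 0 < m → deanCritical L m 1 =
      Real.pi ^ 2 * Real.sqrt (1 + L ^ 2 / (m : ℝ) ^ 2) * (1 + (m : ℝ) ^ 2 / L ^ 2) :=
    fun m hm => deanCritical_one hL (Nat.cast_pos.2 hm)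
  have hlam₀ : deanCritical L m₀ 1 = lam₀ := hc m₀ hm₀
  have hpi : 0 < Real.pi ^ 2 := by positivity
  have hlam₀_pos : 0 < lam₀ := by positivity
  obtain ⟨ε, hε, hgap⟩ := exists_gap_of_tendsto_atTop (tendsto_deanCritical_one hL)
    (p := fun m => 0 < m ∧ m ≠ m₀) (c := lam₀)
    (fun m hm => by rw [hc m hm.1]; exact hstrict m hm.1 hm.2)
  have hle : ∀ m : ℕ, 0 < m → lam₀ ≤ deanCritical L m 1 := by
    intro m hm
    by_cases h : m = m₀
    · rw [h, hlam₀]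
    · linarith [hgap m ⟨hm, h⟩]
  have hfac : ∀ m n : ℕ, 0 < m →
      0 < (m : ℝ) / Real.sqrt ((m : ℝ) ^ 2 + (n : ℝ) ^ 2 * L ^ 2) := by
    intro m n hm
    have : (0 : ℝ) < m := Nat.cast_pos.2 hm
    exact div_pos this (Real.sqrt_pos.2 (by positivity))
  have hβ : ∀ i m n : ℕ, 0 < m → ∀ lam, β i m n lam =
      (m : ℝ) / Real.sqrt ((m : ℝ) ^ 2 + (n : ℝ) ^ 2 * L ^ 2) *
        ((-1) ^ (i + 1) * lam - deanCritical L m n) :=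
    fun i m n hm lam => dean_eigenvalue_eq hL (Nat.cast_pos.2 hm) _
  have hβ₀ : ∀ lam, β 1 m₀ 1 lam =
      (m₀ : ℝ) / Real.sqrt ((m₀ : ℝ) ^ 2 + ((1 : ℕ) : ℝ) ^ 2 * L ^ 2) * (lam - lam₀) := by
    intro lam
    rw [hβ 1 m₀ 1 hm₀, Nat.cast_one, hlam₀]
    norm_num
  refine ⟨min ε (min lam₀ (Real.pi ^ 2)), by positivity, fun lam hlo hhi => ⟨⟨?_, ?_, ?_⟩, ?_⟩⟩
  · intro h
    rw [hβ₀]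
    exact mul_neg_of_pos_of_neg (hfac m₀ 1 hm₀) (by linarith)
  · intro h
    rw [hβ₀, h, sub_self, mul_zero]
  · intro h
    rw [hβ₀]
    exact mul_pos (hfac m₀ 1 hm₀) (by linarith)
  · intro i m n hi hm hn hne
    have hδε := min_le_left ε (min lam₀ (Real.pi ^ 2))
    have hδ' := min_le_right ε (min lam₀ (Real.pi ^ 2))
    have hδlam := hδ'.trans (min_le_left _ _)
    have hδpi := hδ'.trans (min_le_right _ _)
    have hn1 : (1 : ℝ) ≤ n := Nat.one_le_cast.2 hn
    have hmn := deanCritical_one_add_le (L := L) (Nat.cast_pos.2 hm : (0 : ℝ) < m) hn1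
    have hm1 := hle m hm
    have hn2 : 0 ≤ Real.pi ^ 2 * ((n : ℝ) ^ 2 - 1) :=
      mul_nonneg hpi.le (by nlinarith)
    rw [hβ i m n hm]
    refine mul_neg_of_pos_of_neg (hfac m n hm) ?_
    rcases hi with rfl | rfl
    · have hlt : lam < deanCritical L m n := by
        by_cases h : m = m₀
        · have hn_two : (2 : ℝ) ≤ n := by
            have : n ≠ 1 := fun h' => hne (by rw [h, h'])
            exact_mod_cast (by omega : 2 ≤ n)
          have : Real.pi ^ 2 * 1 ≤ Real.pi ^ 2 * ((n : ℝ) ^ 2 - 1) :=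
            mul_le_mul_of_nonneg_left (by nlinarith) hpi.le
          linarith
        · linarith [hgap m ⟨hm, h⟩]
      norm_num
      exact hlt
    · norm_num
      linarith
end

section
/- Let L > 0, r₁ ∈ ℝ, λ ∈ ℝ, m, n positive integers, and i ∈ {1,2}. Set λ_{mn} = −π²(m²/L² + n²), κ = m/√(m² + n²L²), β = λ_{mn} + (−1)^{i+1}λκ, e_{mn}(r,z) = cos(mπz/L)·sin(nπ(r − r₁)), ē_{mn}(r,z) = sin(mπz/L)·cos(nπ(r − r₁)), and define v_r = (−1)^{i+1}·κ·e_{mn}, v_θ = e_{mn}, v_z = (−1)^i·(nL/m)·κ·ē_{mn}. Then there exists a smooth function p : ℝ² → ℝ such that at every point (r,z): Δv_r + λ·v_θ − ∂p/∂r = β·v_r, Δv_θ + λ·v_r = β·v_θ, Δv_z − ∂p/∂z = β·v_z, and ∂v_r/∂r + ∂v_z/∂z = 0, where Δ = ∂²/∂r² + ∂²/∂z². -/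
theorem deriv_const_mul_sin_affine (c b d : ℝ) :
    deriv (fun x : ℝ => c * Real.sin (b * x + d)) = fun x => c * b * Real.cos (b * x + d) := by
  funext x
  have h : HasDerivAt (fun x : ℝ => b * x + d) b x := by
    simpa using ((hasDerivAt_id x).const_mul b).add_const d
  rw [(h.sin.const_mul c).deriv]
  ring

theorem deriv_const_mul_cos_affine (c b d : ℝ) :
    deriv (fun x : ℝ => c * Real.cos (b * x + d)) = fun x => -(c * b) * Real.sin (b * x + d) := by
  funext x
  have h : HasDerivAt (fun x : ℝ => b * x + d) b x := by
    simpa using ((hasDerivAt_id x).const_mul b).add_const d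
  rw [(h.cos.const_mul c).deriv]
  ring

/-- The field `(v_r, v_θ, v_z) = ((-1)^{i+1} κ e_{mn}, e_{mn}, (-1)^i (nL/m) κ ē_{mn})`
is an eigenvector of the linearized narrow-gap Dean operator with eigenvalue
`β = λ_{mn} + (-1)^{i+1} λ κ`: there is a smooth pressure `p` such that
`Δv_r + λ v_θ - ∂p/∂r = β v_r`, `Δv_θ + λ v_r = β v_θ`, `Δv_z - ∂p/∂z = β v_z`, and
`∂v_r/∂r + ∂v_z/∂z = 0` everywhere. -/
theorem dean_eigenvector_pde (L r₁ lam : ℝ) (hL : 0 < L)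
    (m n : ℕ) (hm : 0 < m) (hn : 0 < n) (i : ℕ) (hi : i = 1 ∨ i = 2) :
    let lammn : ℝ := -Real.pi ^ 2 * ((m : ℝ) ^ 2 / L ^ 2 + (n : ℝ) ^ 2)
    let κ : ℝ := (m : ℝ) / Real.sqrt ((m : ℝ) ^ 2 + (n : ℝ) ^ 2 * L ^ 2)
    let β : ℝ := lammn + (-1 : ℝ) ^ (i + 1) * lam * κ
    let e : ℝ → ℝ → ℝ := fun r z =>
      Real.cos ((m : ℝ) * Real.pi * z / L) * Real.sin ((n : ℝ) * Real.pi * (r - r₁))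
    let ebar : ℝ → ℝ → ℝ := fun r z =>
      Real.sin ((m : ℝ) * Real.pi * z / L) * Real.cos ((n : ℝ) * Real.pi * (r - r₁))
    let vr : ℝ → ℝ → ℝ := fun r z => (-1 : ℝ) ^ (i + 1) * κ * e r z
    let vθ : ℝ → ℝ → ℝ := fun r z => e r z
    let vz : ℝ → ℝ → ℝ := fun r z =>
      (-1 : ℝ) ^ i * ((n : ℝ) * L / (m : ℝ)) * κ * ebar r z
    ∃ p : ℝ → ℝ → ℝ, ContDiff ℝ (⊤ : ℕ∞) (fun q : ℝ × ℝ => p q.1 q.2) ∧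
      ∀ r z : ℝ,
        (deriv (deriv (fun s => vr s z)) r + deriv (deriv (fun t => vr r t)) z)
            + lam * vθ r z - deriv (fun s => p s z) r = β * vr r z ∧
        (deriv (deriv (fun s => vθ s z)) r + deriv (deriv (fun t => vθ r t)) z)
            + lam * vr r z = β * vθ r z ∧
        (deriv (deriv (fun s => vz s z)) r + deriv (deriv (fun t => vz r t)) z)
            - deriv (fun t => p r t) z = β * vz r z ∧
        deriv (fun s => vr s z) r + deriv (fun t => vz r t) z = 0 := by
  intro lammn κ β e ebar vr vθ vz
  have hm' : (0 : ℝ) < m := by exact_mod_cast hm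
  have hn' : (0 : ℝ) < n := by exact_mod_cast hn
  have hπ := Real.pi_pos
  obtain ⟨σ, hσ⟩ : ∃ σ : ℝ, σ = (-1 : ℝ) ^ (i + 1) := ⟨_, rfl⟩
  have hσ' : (-1 : ℝ) ^ i = -σ := by rw [hσ, pow_succ]; ring
  have hσ2 : σ ^ 2 = 1 := by rw [hσ, ← pow_mul, mul_comm, pow_mul]; norm_num
  have hD : (0 : ℝ) < (m : ℝ) ^ 2 + (n : ℝ) ^ 2 * L ^ 2 := by positivity
  have hκ2 : κ ^ 2 = (m : ℝ) ^ 2 / ((m : ℝ) ^ 2 + (n : ℝ) ^ 2 * L ^ 2) := by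
    simp only [κ, div_pow, Real.sq_sqrt hD.le]
  obtain ⟨a, ha⟩ : ∃ a : ℝ, a = m * Real.pi / L := ⟨_, rfl⟩
  obtain ⟨b, hb⟩ : ∃ b : ℝ, b = n * Real.pi := ⟨_, rfl⟩
  have hb0 : b ≠ 0 := by rw [hb]; positivity
  have hlam : lammn = -(a ^ 2 + b ^ 2) := by simp only [lammn, ha, hb]; ring
  have hratio : (n : ℝ) * L / m * a = b := by rw [ha, hb]; field_simp
  have hpress : (1 - κ ^ 2) * a = κ ^ 2 * ((n : ℝ) * L / m) * b := by
    rw [hκ2, ha, hb]; field_simp; ring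
  have he : e = fun r z => Real.cos (a * z + 0) * Real.sin (b * r + -(b * r₁)) := by
    funext r z
    simp only [e, ha, hb]
    congr 2 <;> ring
  have hebar : ebar = fun r z => Real.sin (a * z + 0) * Real.cos (b * r + -(b * r₁)) := by
    funext r z
    simp only [ebar, ha, hb]
    congr 2 <;> ring
  have sinr : ∀ A B : ℝ, deriv (fun s : ℝ => A * (B * Real.sin (b * s + -(b * r₁)))) =
      fun s => A * B * b * Real.cos (b * s + -(b * r₁)) := fun A B => by
    simpa only [mul_assoc] using deriv_const_mul_sin_affine (A * B) b (-(b * r₁))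
  have cosr : ∀ A B : ℝ, deriv (fun s : ℝ => A * (B * Real.cos (b * s + -(b * r₁)))) =
      fun s => -(A * B * b) * Real.sin (b * s + -(b * r₁)) := fun A B => by
    simpa only [mul_assoc] using deriv_const_mul_cos_affine (A * B) b (-(b * r₁))
  have sinz : ∀ A B : ℝ, deriv (fun t : ℝ => A * (Real.sin (a * t + 0) * B)) =
      fun t => A * B * a * Real.cos (a * t + 0) := fun A B => by
    rw [← deriv_const_mul_sin_affine (A * B) a 0]; congr 1; funext t; ring
  have cosz : ∀ A B : ℝ, deriv (fun t : ℝ => A * (Real.cos (a * t + 0) * B)) =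
      fun t => -(A * B * a) * Real.sin (a * t + 0) := fun A B => by
    rw [← deriv_const_mul_cos_affine (A * B) a 0]; congr 1; funext t; ring
  have hvr : vr = fun r z => σ * κ * (Real.cos (a * z + 0) * Real.sin (b * r + -(b * r₁))) := by
    simp only [vr, he, hσ]
  have hvθ : vθ = fun r z => 1 * (Real.cos (a * z + 0) * Real.sin (b * r + -(b * r₁))) := by
    simp only [vθ, he, one_mul]
  have hvz : vz = fun r z => -σ * ((n : ℝ) * L / m) * κ *
      (Real.sin (a * z + 0) * Real.cos (b * r + -(b * r₁))) := by
    simp only [vz, hebar, hσ']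
  have hβ : β = -(a ^ 2 + b ^ 2) + σ * lam * κ := by simp only [β, hlam, hσ]
  clear_value vr vθ vz β κ
  subst hvr hvθ hvz hβ
  refine ⟨fun r z => -(lam * (1 - κ ^ 2) / b) *
    (Real.cos (a * z + 0) * Real.cos (b * r + -(b * r₁))), by fun_prop, fun r z => ?_⟩
  generalize (n : ℝ) * L / m = ρ at *
  simp only [sinr, cosr, sinz, cosz, deriv_const_mul_sin_affine, deriv_const_mul_cos_affine]
  generalize Real.cos (a * z + 0) = cz
  generalize Real.sin (a * z + 0) = sz
  generalize Real.cos (b * r + -(b * r₁)) = cr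
  generalize Real.sin (b * r + -(b * r₁)) = sr
  refine ⟨?_, by ring, ?_, ?_⟩
  · field_simp
    linear_combination (-lam * κ ^ 2 * cz * sr) * hσ2
  · field_simp
    linear_combination (-lam * sz * cr) * hpress + (lam * κ ^ 2 * ρ * b * sz * cr) * hσ2
  · linear_combination (-σ * κ * cz * cr) * hratio
end

section
/- Let L > 0 and r₁ ∈ ℝ, and let Ω = (r₁, r₁+1) × (0, L). For positive integers m, n and i ∈ {1,2} define the ℝ³-valued function f^i_{mn}(r,z) = (2/L)·((−1)^{i+1}·κ_{mn}·e_{mn}(r,z), e_{mn}(r,z), (−1)^i·(nL/m)·κ_{mn}·ē_{mn}(r,z)), where κ_{mn} = m/√(m² + n²L²), e_{mn}(r,z) = cos(mπz/L)·sin(nπ(r−r₁)), ē_{mn}(r,z) = sin(mπz/L)·cos(nπ(r−r₁)). Then for any two index triples (i,m,n) ≠ (j,s,k), the L² inner product ∫_Ω f^i_{mn}(r,z) · f^j_{sk}(r,z) dr dz equals 0. -/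
theorem integral_cos_int_mul_pi {p : ℤ} (hp : p ≠ 0) :
    ∫ x in (0 : ℝ)..1, Real.cos ((p : ℝ) * Real.pi * x) = 0 := by
  have h : (p : ℝ) * Real.pi ≠ 0 := mul_ne_zero (Int.cast_ne_zero.mpr hp) Real.pi_ne_zero
  rw [intervalIntegral.integral_comp_mul_left (fun x => Real.cos x) h]
  simp [Real.sin_int_mul_pi]

theorem integral_cos_sub_cos_add {m s : ℕ} (hm : 0 < m) (ε : ℝ) :
    ∫ x in (0 : ℝ)..1, (Real.cos (((m - s : ℤ) : ℝ) * Real.pi * x)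
      + ε * Real.cos (((m + s : ℤ) : ℝ) * Real.pi * x)) / 2
      = if m = s then 1 / 2 else 0 := by
  rw [intervalIntegral.integral_div, intervalIntegral.integral_add
    (Continuous.intervalIntegrable (by fun_prop) _ _)
    (Continuous.intervalIntegrable (by fun_prop) _ _),
    intervalIntegral.integral_const_mul, integral_cos_int_mul_pi (p := m + s) (by lia)]
  split_ifs with h
  · simp [h]
  · rw [integral_cos_int_mul_pi (p := m - s) (by lia)]
    simp

theorem integral_cos_mul_cos_nat_mul_pi {m : ℕ} (hm : 0 < m) (s : ℕ) :
    ∫ x in (0 : ℝ)..1, Real.cos ((m : ℝ) * Real.pi * x) * Real.cos ((s : ℝ) * Real.pi * x)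
      = if m = s then 1 / 2 else 0 := by
  rw [← integral_cos_sub_cos_add hm 1]
  congr 1 with x
  push_cast
  rw [sub_mul, sub_mul, add_mul, add_mul, Real.cos_sub, Real.cos_add]
  ring

theorem integral_sin_mul_sin_nat_mul_pi {m : ℕ} (hm : 0 < m) (s : ℕ) :
    ∫ x in (0 : ℝ)..1, Real.sin ((m : ℝ) * Real.pi * x) * Real.sin ((s : ℝ) * Real.pi * x)
      = if m = s then 1 / 2 else 0 := by
  rw [← integral_cos_sub_cos_add hm (-1)]
  congr 1 with x
  push_cast
  rw [sub_mul, sub_mul, add_mul, add_mul, Real.cos_sub, Real.cos_add]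
  ring

theorem integral_comp_div_unit {L : ℝ} (hL : L ≠ 0) (g : ℝ → ℝ) :
    ∫ z in (0 : ℝ)..L, g (z / L) = L * ∫ x in (0 : ℝ)..1, g x := by
  rw [intervalIntegral.integral_comp_div g hL, zero_div, div_self hL, smul_eq_mul]

theorem integral_comp_sub_unit (a : ℝ) (g : ℝ → ℝ) :
    ∫ r in a..(a + 1), g (r - a) = ∫ x in (0 : ℝ)..1, g x := by
  rw [intervalIntegral.integral_comp_sub_right g a, sub_self, add_sub_cancel_left]

theorem integral_integral_sum_of_products {L : ℝ} (hL : L ≠ 0) (r₁ a b : ℝ)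
    {u v p q : ℝ → ℝ} (hu : Continuous u) (hv : Continuous v)
    (hp : Continuous p) (hq : Continuous q) :
    ∫ r in r₁..(r₁ + 1), ∫ z in (0 : ℝ)..L,
      (a * p (r - r₁) * u (z / L) + b * q (r - r₁) * v (z / L))
      = L * (a * (∫ x in (0 : ℝ)..1, p x) * (∫ x in (0 : ℝ)..1, u x)
        + b * (∫ x in (0 : ℝ)..1, q x) * ∫ x in (0 : ℝ)..1, v x) := by
  have inner (r : ℝ) : ∫ z in (0 : ℝ)..L,
      (a * p (r - r₁) * u (z / L) + b * q (r - r₁) * v (z / L))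
      = a * p (r - r₁) * (L * ∫ x in (0 : ℝ)..1, u x)
        + b * q (r - r₁) * (L * ∫ x in (0 : ℝ)..1, v x) := by
    rw [intervalIntegral.integral_add
      (Continuous.intervalIntegrable (by fun_prop) _ _)
      (Continuous.intervalIntegrable (by fun_prop) _ _),
      intervalIntegral.integral_const_mul, intervalIntegral.integral_const_mul,
      integral_comp_div_unit hL, integral_comp_div_unit hL]
  simp_rw [inner]
  rw [intervalIntegral.integral_add
    (Continuous.intervalIntegrable (by fun_prop) _ _)
    (Continuous.intervalIntegrable (by fun_prop) _ _),
    intervalIntegral.integral_mul_const, intervalIntegral.integral_mul_const,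
    intervalIntegral.integral_const_mul, intervalIntegral.integral_const_mul,
    integral_comp_sub_unit, integral_comp_sub_unit]
  ring


/-- Orthogonality of the eigenvectors
`f^i_{mn} = (2/L)((-1)^{i+1} κ_{mn} e_{mn}, e_{mn}, (-1)^i (nL/m) κ_{mn} ē_{mn})`
of the linearized Dean operator: for distinct index triples `(i,m,n) ≠ (j,s,k)` the
`L²(Ω, ℝ³)` inner product over `Ω = (r₁, r₁+1) × (0, L)` vanishes. -/
theorem dean_eigenvectors_orthogonal (L r₁ : ℝ) (hL : 0 < L)
    (m n s k : ℕ) (hm : 0 < m) (hn : 0 < n) (hs : 0 < s) (hk : 0 < k)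
    (i j : ℕ) (hi : i = 1 ∨ i = 2) (hj : j = 1 ∨ j = 2)
    (hne : (i, m, n) ≠ (j, s, k)) :
    let κ : ℕ → ℕ → ℝ := fun m n =>
      (m : ℝ) / Real.sqrt ((m : ℝ) ^ 2 + (n : ℝ) ^ 2 * L ^ 2)
    let e : ℕ → ℕ → ℝ → ℝ → ℝ := fun m n r z =>
      Real.cos ((m : ℝ) * Real.pi * z / L) * Real.sin ((n : ℝ) * Real.pi * (r - r₁))
    let ebar : ℕ → ℕ → ℝ → ℝ → ℝ := fun m n r z =>
      Real.sin ((m : ℝ) * Real.pi * z / L) * Real.cos ((n : ℝ) * Real.pi * (r - r₁))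
    let f : ℕ → ℕ → ℕ → ℝ → ℝ → Fin 3 → ℝ := fun i m n r z =>
      ![2 / L * ((-1 : ℝ) ^ (i + 1) * κ m n * e m n r z),
        2 / L * e m n r z,
        2 / L * ((-1 : ℝ) ^ i * ((n : ℝ) * L / (m : ℝ)) * κ m n * ebar m n r z)]
    ∫ r in r₁..(r₁ + 1), ∫ z in (0 : ℝ)..L,
      (∑ c : Fin 3, f i m n r z c * f j s k r z c) = 0 := by
  intro κ e ebar f
  have integrand (r z : ℝ) : ∑ c : Fin 3, f i m n r z c * f j s k r z c
      = ((2 / L) ^ 2 * ((-1) ^ (i + 1) * (-1) ^ (j + 1) * κ m n * κ s k + 1))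
          * (Real.sin ((n : ℝ) * Real.pi * (r - r₁)) * Real.sin ((k : ℝ) * Real.pi * (r - r₁)))
          * (Real.cos ((m : ℝ) * Real.pi * (z / L)) * Real.cos ((s : ℝ) * Real.pi * (z / L)))
        + ((2 / L) ^ 2 * ((-1) ^ i * (-1) ^ j * (n * L / m) * (k * L / s) * κ m n * κ s k))
          * (Real.cos ((n : ℝ) * Real.pi * (r - r₁)) * Real.cos ((k : ℝ) * Real.pi * (r - r₁)))
          * (Real.sin ((m : ℝ) * Real.pi * (z / L)) * Real.sin ((s : ℝ) * Real.pi * (z / L))) := by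
    simp only [Fin.sum_univ_three, f, e, ebar, Matrix.cons_val, mul_div_assoc]
    ring
  simp_rw [integrand]
  rw [integral_integral_sum_of_products hL.ne' r₁ _ _
    (u := fun x => Real.cos ((m : ℝ) * Real.pi * x) * Real.cos ((s : ℝ) * Real.pi * x))
    (v := fun x => Real.sin ((m : ℝ) * Real.pi * x) * Real.sin ((s : ℝ) * Real.pi * x))
    (p := fun x => Real.sin ((n : ℝ) * Real.pi * x) * Real.sin ((k : ℝ) * Real.pi * x))
    (q := fun x => Real.cos ((n : ℝ) * Real.pi * x) * Real.cos ((k : ℝ) * Real.pi * x))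
    (by fun_prop) (by fun_prop) (by fun_prop) (by fun_prop),
    integral_cos_mul_cos_nat_mul_pi hm, integral_sin_mul_sin_nat_mul_pi hm,
    integral_cos_mul_cos_nat_mul_pi hn, integral_sin_mul_sin_nat_mul_pi hn]
  by_cases hms : m = s
  swap
  · simp [hms]
  by_cases hnk : n = k
  swap
  · simp [hnk]
  subst hms hnk
  have hm' : (0 : ℝ) < m := by exact_mod_cast hm
  have hsign : (-1 : ℝ) ^ i * (-1) ^ j = -1 := by
    rcases hi with rfl | rfl <;> rcases hj with rfl | rfl <;> simp at hne ⊢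
  have hκ : κ m n * κ m n * (1 + (n * L / m) * (n * L / m)) = 1 := by
    have hpos : (0 : ℝ) < (m : ℝ) ^ 2 + (n : ℝ) ^ 2 * L ^ 2 := by positivity
    have hsq : κ m n * κ m n = (m : ℝ) ^ 2 / ((m : ℝ) ^ 2 + (n : ℝ) ^ 2 * L ^ 2) := by
      simp only [κ]
      rw [div_mul_div_comm, Real.mul_self_sqrt hpos.le, sq (m : ℝ)]
    rw [hsq]
    field_simp
  simp only [if_true, pow_succ (-1 : ℝ)]
  linear_combination (L * (2 / L) ^ 2 / 4) * (κ m n * κ m n * (1 + (n * L / m) * (n * L / m)))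
    * hsign - (L * (2 / L) ^ 2 / 4) * hκ
end
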